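/- arXiv:1502.00083 — 5 statements merged into one kernel-verified Lean document; each statement's English description precedes it below -/
import Mathlib

section
/- Let B, C be bounded linear operators on a nonzero complex Hilbert space H and let p ≥ 2. Then w_p(B,C) ≥ 2^{1/p - 2} · ‖B*B + C*C‖^{1/2}. -/
open scoped InnerProductSpace
open ContinuousLinearMap Complex

variable {H : Type*} [NormedAddCommGroup H] [InnerProductSpace ℂ H] [CompleteSpace H] [Nontrivial H]

/-- The numerical radius of a bounded linear operator. -/
noncomputable def nrad (T : H →L[ℂ] H) : ℝ :=
  ⨆ x : {x : H // ‖x‖ = 1}, ‖⟪T x, x⟫_ℂ‖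

/-- The generalized Euclidean operator radius `w_p` of a pair of operators. -/
noncomputable def wp2 (p : ℝ) (B C : H →L[ℂ] H) : ℝ :=
  ⨆ x : {x : H // ‖x‖ = 1}, (‖⟪B x, x⟫_ℂ‖ ^ p + ‖⟪C x, x⟫_ℂ‖ ^ p) ^ (1/p)

/-- If the quadratic form of `T` is bounded by `r`, then `‖T‖ ≤ 2 * r`. -/
theorem opNorm_le_two_mul_of_inner_self_le {E : Type*} [NormedAddCommGroup E]
    [InnerProductSpace ℂ E] (T : E →L[ℂ] E) {r : ℝ} (hr : 0 ≤ r)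
    (h : ∀ x : E, ‖⟪T x, x⟫_ℂ‖ ≤ r * ‖x‖ ^ 2) : ‖T‖ ≤ 2 * r := by
  have sesq (x y : E) : ‖⟪T y, x⟫_ℂ‖ ≤ r * (‖x‖ ^ 2 + ‖y‖ ^ 2) := by
    have e := inner_map_polarization (T : E →ₗ[ℂ] E) x y
    simp only [ContinuousLinearMap.coe_coe] at e
    have p₁ := parallelogram_law_with_norm ℂ x y
    have p₂ := parallelogram_law_with_norm ℂ x (I • y)
    have hI : ‖I • y‖ = ‖y‖ := by simp [norm_smul]
    rw [hI] at p₂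
    have h₁ := h (x + y)
    have h₂ := h (x - y)
    have h₃ := h (x + I • y)
    have h₄ := h (x - I • y)
    rw [e, norm_div]
    have four : ‖(4 : ℂ)‖ = 4 := by norm_num
    rw [four, div_le_iff₀ (by norm_num)]
    refine (norm_sub_le _ _).trans ?_
    refine (add_le_add_left (norm_add_le _ _) _).trans ?_
    refine (add_le_add_left (add_le_add_left (norm_sub_le _ _) _) _).trans ?_
    simp only [norm_mul, norm_I, one_mul]
    linear_combination h₁ + h₂ + h₃ + h₄ + r * p₁ + r * p₂
  refine T.opNorm_le_bound (by positivity) fun x => ?_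
  rcases eq_or_ne (T x) 0 with h0 | h0
  · rw [h0, norm_zero]
    positivity
  have hT : 0 < ‖T x‖ := norm_pos_iff.2 h0
  have hx : 0 < ‖x‖ := norm_pos_iff.2 (by rintro rfl; simp at h0)
  have key := sesq (((‖x‖ / ‖T x‖ : ℝ) : ℂ) • T x) x
  rw [inner_smul_right, inner_self_eq_norm_sq_to_K, norm_smul, norm_mul, norm_pow] at key
  simp only [norm_real, coe_algebraMap, norm_div, norm_norm] at key
  rw [div_mul_cancel₀ _ hT.ne'] at key
  have e : ‖x‖ / ‖T x‖ * ‖T x‖ ^ 2 = ‖x‖ * ‖T x‖ := by field_simp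
  rw [e] at key
  refine le_of_mul_le_mul_left ?_ hx
  linarith

theorem wp2_bddAbove (B C : H →L[ℂ] H) {p : ℝ} (hp : 0 < p) :
    BddAbove (Set.range fun x : {x : H // ‖x‖ = 1} =>
      (‖⟪B x, x⟫_ℂ‖ ^ p + ‖⟪C x, x⟫_ℂ‖ ^ p) ^ (1/p)) := by
  have bound (T : H →L[ℂ] H) (x : {x : H // ‖x‖ = 1}) : ‖⟪T x, x⟫_ℂ‖ ≤ ‖T‖ := by
    refine (norm_inner_le_norm _ _).trans ?_
    simpa [x.2] using T.le_opNorm x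
  refine ⟨(‖B‖ ^ p + ‖C‖ ^ p) ^ (1/p), ?_⟩
  rintro _ ⟨x, rfl⟩
  have hB := bound B x
  have hC := bound C x
  dsimp only
  gcongr

theorem wp2_comm (B C : H →L[ℂ] H) (p : ℝ) : wp2 p B C = wp2 p C B := by
  simp only [wp2, add_comm]

theorem wp2_nonneg (B C : H →L[ℂ] H) (p : ℝ) : 0 ≤ wp2 p B C :=
  Real.iSup_nonneg fun _ => by positivity

theorem norm_inner_self_le_wp2 (B C : H →L[ℂ] H) {p : ℝ} (hp : 0 < p) (x : H) :
    ‖⟪B x, x⟫_ℂ‖ ≤ wp2 p B C * ‖x‖ ^ 2 := by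
  rcases eq_or_ne x 0 with rfl | hx
  · simp
  have unit (u : {x : H // ‖x‖ = 1}) : ‖⟪B u, u⟫_ℂ‖ ≤ wp2 p B C := by
    refine le_trans ?_ (le_ciSup (wp2_bddAbove B C hp) u)
    calc ‖⟪B u, u⟫_ℂ‖ = (‖⟪B u, u⟫_ℂ‖ ^ p) ^ (1/p) := by
          rw [one_div, Real.rpow_rpow_inv (norm_nonneg _) hp.ne']
      _ ≤ _ := by
          gcongr
          exact le_add_of_nonneg_right (by positivity)
  have hx' : 0 < ‖x‖ := norm_pos_iff.2 hx
  have key := unit ⟨((‖x‖⁻¹ : ℝ) : ℂ) • x, by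
    rw [norm_smul, norm_real, norm_inv, norm_norm, inv_mul_cancel₀ hx'.ne']⟩
  simp only [map_smul, inner_smul_left, inner_smul_right, norm_mul, conj_ofReal, norm_real,
    norm_inv, norm_norm] at key
  rw [← div_le_iff₀ (by positivity)]
  refine le_of_eq_of_le ?_ key
  field_simp

theorem norm_le_two_mul_wp2 (B C : H →L[ℂ] H) {p : ℝ} (hp : 0 < p) :
    ‖B‖ ≤ 2 * wp2 p B C :=
  opNorm_le_two_mul_of_inner_self_le B (wp2_nonneg B C p) (norm_inner_self_le_wp2 B C hp)

theorem stmt1 (B C : H →L[ℂ] H) (p : ℝ) (hp : 2 ≤ p) :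
    wp2 p B C ≥ (2 : ℝ) ^ (1/p - 2) * ‖adjoint B * B + adjoint C * C‖ ^ ((1 : ℝ)/2) := by
  have hp0 : 0 < p := by linarith
  set W := wp2 p B C with hW
  have hW0 : 0 ≤ W := wp2_nonneg B C p
  have hB : ‖B‖ ≤ 2 * W := norm_le_two_mul_wp2 B C hp0
  have hC : ‖C‖ ≤ 2 * W := by
    rw [hW, wp2_comm]
    exact norm_le_two_mul_wp2 C B hp0
  have hsum : ‖adjoint B * B + adjoint C * C‖ ≤ 8 * W ^ 2 := by
    have h (T : H →L[ℂ] H) : ‖adjoint T * T‖ = ‖T‖ * ‖T‖ := CStarRing.norm_star_mul_self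
    refine (norm_add_le _ _).trans ?_
    rw [h, h]
    nlinarith [norm_nonneg B, norm_nonneg C]
  have hexp : 1 / p - 2 ≤ -(3 / 2 : ℝ) := by
    have : 1 / p ≤ 1 / 2 := one_div_le_one_div_of_le (by norm_num) hp
    linarith
  have h8 : (8 * W ^ 2) ^ ((1 : ℝ) / 2) = (2 : ℝ) ^ (3 / 2 : ℝ) * W := by
    rw [Real.mul_rpow (by norm_num) (by positivity), ← Real.sqrt_eq_rpow (W ^ 2),
      Real.sqrt_sq hW0, show (8 : ℝ) = 2 ^ (3 : ℝ) by norm_num, ← Real.rpow_mul (by norm_num)]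
    norm_num
  calc (2 : ℝ) ^ (1/p - 2) * ‖adjoint B * B + adjoint C * C‖ ^ ((1 : ℝ)/2)
      ≤ (2 : ℝ) ^ (-(3 / 2 : ℝ)) * (8 * W ^ 2) ^ ((1 : ℝ)/2) := by
        gcongr
        norm_num
    _ = W := by
        rw [h8, ← mul_assoc, ← Real.rpow_add (by norm_num)]
        simp
end

section
/- Let B, C be bounded linear operators on a nonzero complex Hilbert space H and let p ≥ 1. Then w_p(B,C) ≥ 2^{1/p - 1} · max( w(B + C), w(B - C) ). -/
open scoped InnerProductSpace
open ContinuousLinearMap Complex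

variable {H : Type*} [NormedAddCommGroup H] [InnerProductSpace ℂ H] [CompleteSpace H] [Nontrivial H]

theorem two_rpow_mul_add_le_rpow_add_rpow {a b p : ℝ} (ha : 0 ≤ a) (hb : 0 ≤ b) (hp : 1 ≤ p) :
    (2 : ℝ) ^ (1/p - 1) * (a + b) ≤ (a ^ p + b ^ p) ^ (1/p) := by
  have hp0 : 0 < p := by linarith
  have h : (a + b) ^ p ≤ (2 : ℝ) ^ (p - 1) * (a ^ p + b ^ p) := by
    exact_mod_cast NNReal.rpow_add_le_mul_rpow_add_rpow ⟨a, ha⟩ ⟨b, hb⟩ hp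
  rw [one_div, Real.le_rpow_inv_iff_of_pos (by positivity) (by positivity) hp0,
    Real.mul_rpow (by positivity) (by positivity), ← Real.rpow_mul (by norm_num)]
  calc (2 : ℝ) ^ ((p⁻¹ - 1) * p) * (a + b) ^ p
      ≤ (2 : ℝ) ^ ((p⁻¹ - 1) * p) * ((2 : ℝ) ^ (p - 1) * (a ^ p + b ^ p)) := by gcongr
    _ = a ^ p + b ^ p := by
      rw [← mul_assoc, ← Real.rpow_add (by norm_num)]
      have : (p⁻¹ - 1) * p + (p - 1) = 0 := by field_simp; ring
      rw [this, Real.rpow_zero, one_mul]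

theorem norm_inner_apply_self_le (T : H →L[ℂ] H) (x : {x : H // ‖x‖ = 1}) :
    ‖⟪T x, x⟫_ℂ‖ ≤ ‖T‖ := by
  have h₁ := norm_inner_le_norm (𝕜 := ℂ) (T x) (x : H)
  have h₂ := T.le_opNorm x
  rw [x.2, mul_one] at h₁ h₂
  exact h₁.trans h₂

theorem le_wp2 (B C : H →L[ℂ] H) {p : ℝ} (hp : 0 ≤ p) (x : {x : H // ‖x‖ = 1}) :
    (‖⟪B x, x⟫_ℂ‖ ^ p + ‖⟪C x, x⟫_ℂ‖ ^ p) ^ (1/p) ≤ wp2 p B C := by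
  refine le_ciSup (f := fun x : {x : H // ‖x‖ = 1} =>
    (‖⟪B x, x⟫_ℂ‖ ^ p + ‖⟪C x, x⟫_ℂ‖ ^ p) ^ (1/p)) ⟨(‖B‖ ^ p + ‖C‖ ^ p) ^ (1/p), ?_⟩ x
  rintro _ ⟨y, rfl⟩
  have hB := norm_inner_apply_self_le B y
  have hC := norm_inner_apply_self_le C y
  dsimp only
  gcongr

theorem two_rpow_mul_nrad_le_wp2 (B C T : H →L[ℂ] H) {p : ℝ} (hp : 1 ≤ p)
    (hT : ∀ x : H, ‖⟪T x, x⟫_ℂ‖ ≤ ‖⟪B x, x⟫_ℂ‖ + ‖⟪C x, x⟫_ℂ‖) :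
    (2 : ℝ) ^ (1/p - 1) * nrad T ≤ wp2 p B C := by
  obtain ⟨v, hv⟩ := exists_norm_eq H zero_le_one
  have : Nonempty {x : H // ‖x‖ = 1} := ⟨⟨v, hv⟩⟩
  rw [nrad, Real.mul_iSup_of_nonneg (by positivity)]
  refine ciSup_le fun x => ?_
  calc _ ≤ (2 : ℝ) ^ (1/p - 1) * (‖⟪B x, x⟫_ℂ‖ + ‖⟪C x, x⟫_ℂ‖) := by
        gcongr
        exact hT x
    _ ≤ _ := two_rpow_mul_add_le_rpow_add_rpow (norm_nonneg _) (norm_nonneg _) hp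
    _ ≤ _ := le_wp2 B C (by linarith) x

theorem stmt2 (B C : H →L[ℂ] H) (p : ℝ) (hp : 1 ≤ p) :
    wp2 p B C ≥ (2 : ℝ) ^ (1/p - 1) * max (nrad (B + C)) (nrad (B - C)) := by
  rw [ge_iff_le, mul_max_of_nonneg _ _ (by positivity)]
  refine max_le (two_rpow_mul_nrad_le_wp2 B C _ hp fun x => ?_)
    (two_rpow_mul_nrad_le_wp2 B C _ hp fun x => ?_)
  · rw [add_apply, inner_add_left]
    exact norm_add_le _ _
  · rw [sub_apply, inner_sub_left]
    exact norm_sub_le _ _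
end

section
/- Let A be a bounded linear operator on a nonzero complex Hilbert space H with Cartesian decomposition A = B + iC (so B = (A + A*)/2 and C = (A - A*)/(2i) are self-adjoint), and let p ≥ 2. Then w_p(B,C) ≥ 2^{1/p - 1} · max( ‖B + C‖, ‖B - C‖ ), and w(A) ≥ 2^{1/p - 2} · max( ‖(1-i)A + (1+i)A*‖, ‖(1+i)A + (1-i)A*‖ ). -/
open scoped InnerProductSpace
open ContinuousLinearMap Complex

variable {H : Type*} [NormedAddCommGroup H] [InnerProductSpace ℂ H] [CompleteSpace H] [Nontrivial H]

/-- A self-adjoint operator is bounded in norm by any bound of its quadratic form on the unit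
sphere. -/
theorem norm_le_of_forall_unit_inner_le {T : H →L[ℂ] H} (hT : IsSelfAdjoint T) {M : ℝ}
    (h : ∀ x : H, ‖x‖ = 1 → ‖⟪T x, x⟫_ℂ‖ ≤ M) : ‖T‖ ≤ M := by
  obtain ⟨e, he⟩ := exists_norm_eq H zero_le_one
  have hM : 0 ≤ M := (norm_nonneg _).trans (h e he)
  rw [norm_eq_iSup_rayleighQuotient T hT.isSymmetric]
  refine ciSup_le fun x => ?_
  rcases eq_or_ne x 0 with rfl | hx
  · simpa using hM
  · have hx' : (‖x‖ : ℂ)⁻¹ ≠ 0 := by simpa using hx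
    rw [← rayleigh_smul T x hx']
    have hn : ‖(‖x‖ : ℂ)⁻¹ • x‖ = 1 := by
      rw [norm_smul, norm_inv, norm_real, norm_norm, inv_mul_cancel₀ (norm_ne_zero_iff.2 hx)]
    rw [rayleighQuotient, hn, reApplyInnerSelf_apply, one_pow, div_one]
    exact (abs_re_le_norm _).trans (h _ hn)

theorem norm_inner_apply_self_le_s3 {E : Type*} [NormedAddCommGroup E] [InnerProductSpace ℂ E]
    (T : E →L[ℂ] E) {x : E} (hx : ‖x‖ = 1) :
    ‖⟪T x, x⟫_ℂ‖ ≤ ‖T‖ := by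
  simpa [hx] using (norm_inner_le_norm (𝕜 := ℂ) (T x) x).trans
    (mul_le_mul_of_nonneg_right (T.le_opNorm x) (norm_nonneg x))

theorem norm_inner_le_nrad {E : Type*} [NormedAddCommGroup E] [InnerProductSpace ℂ E]
    (T : E →L[ℂ] E) {x : E} (hx : ‖x‖ = 1) :
    ‖⟪T x, x⟫_ℂ‖ ≤ nrad T :=
  le_ciSup (f := fun x : {x : E // ‖x‖ = 1} => ‖⟪T x, (x : E)⟫_ℂ‖)
    ⟨‖T‖, by rintro _ ⟨y, rfl⟩; exact norm_inner_apply_self_le_s3 T y.2⟩ ⟨x, hx⟩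

theorem rpow_norm_inner_le_wp2 {E : Type*} [NormedAddCommGroup E] [InnerProductSpace ℂ E]
    {p : ℝ} (hp : 0 ≤ p) (B C : E →L[ℂ] E) {x : E} (hx : ‖x‖ = 1) :
    (‖⟪B x, x⟫_ℂ‖ ^ p + ‖⟪C x, x⟫_ℂ‖ ^ p) ^ (1 / p) ≤ wp2 p B C := by
  refine le_ciSup (f := fun x : {x : E // ‖x‖ = 1} =>
    (‖⟪B x, (x : E)⟫_ℂ‖ ^ p + ‖⟪C x, (x : E)⟫_ℂ‖ ^ p) ^ (1 / p))
    ⟨(‖B‖ ^ p + ‖C‖ ^ p) ^ (1 / p), ?_⟩ ⟨x, hx⟩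
  rintro _ ⟨y, rfl⟩
  have hB := norm_inner_apply_self_le_s3 B y.2
  have hC := norm_inner_apply_self_le_s3 C y.2
  dsimp only
  gcongr

theorem rpow_mul_add_le_rpow_add_rpow {p a b : ℝ} (hp : 1 ≤ p) (ha : 0 ≤ a) (hb : 0 ≤ b) :
    (2 : ℝ) ^ (1 / p - 1) * (a + b) ≤ (a ^ p + b ^ p) ^ (1 / p) := by
  have hp0 : 0 < p := by linarith
  have h : (a + b) ^ p ≤ 2 ^ (p - 1) * (a ^ p + b ^ p) := by
    lift a to NNReal using ha
    lift b to NNReal using hb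
    exact_mod_cast NNReal.rpow_add_le_mul_rpow_add_rpow a b hp
  rw [one_div, Real.le_rpow_inv_iff_of_pos (by positivity) (by positivity) hp0,
    Real.mul_rpow (by positivity) (by positivity), ← Real.rpow_mul zero_le_two]
  calc (2 : ℝ) ^ ((p⁻¹ - 1) * p) * (a + b) ^ p
      ≤ 2 ^ ((p⁻¹ - 1) * p) * (2 ^ (p - 1) * (a ^ p + b ^ p)) := by gcongr
    _ = a ^ p + b ^ p := by
      rw [← mul_assoc, ← Real.rpow_add zero_lt_two]
      have : (p⁻¹ - 1) * p + (p - 1) = 0 := by field_simp; ring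
      rw [this, Real.rpow_zero, one_mul]

/-- A self-adjoint operator whose quadratic form is dominated by those of `B` and `C` satisfies the
corresponding norm bound in terms of `wp2`. -/
theorem rpow_mul_norm_le_wp2 {p : ℝ} (hp : 1 ≤ p) {B C T : H →L[ℂ] H} (hT : IsSelfAdjoint T)
    (h : ∀ x : H, ‖⟪T x, x⟫_ℂ‖ ≤ ‖⟪B x, x⟫_ℂ‖ + ‖⟪C x, x⟫_ℂ‖) :
    (2 : ℝ) ^ (1 / p - 1) * ‖T‖ ≤ wp2 p B C := by
  rw [← le_div_iff₀' (by positivity)]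
  refine norm_le_of_forall_unit_inner_le hT fun x hx => ?_
  rw [le_div_iff₀' (by positivity)]
  calc (2 : ℝ) ^ (1 / p - 1) * ‖⟪T x, x⟫_ℂ‖
      ≤ 2 ^ (1 / p - 1) * (‖⟪B x, x⟫_ℂ‖ + ‖⟪C x, x⟫_ℂ‖) := by gcongr; exact h x
    _ ≤ _ := rpow_mul_add_le_rpow_add_rpow hp (norm_nonneg _) (norm_nonneg _)
    _ ≤ _ := rpow_norm_inner_le_wp2 (by linarith) B C hx

theorem norm_smul_add_smul_adjoint_le (A : H →L[ℂ] H) (c : ℂ) :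
    ‖c • A + star c • adjoint A‖ ≤ 2 * ‖c‖ * nrad A := by
  have hT : IsSelfAdjoint (c • A + star c • adjoint A) := by
    rw [← star_eq_adjoint, ← star_smul]
    exact IsSelfAdjoint.add_star_self _
  refine norm_le_of_forall_unit_inner_le hT fun x hx => ?_
  have hadj : ‖⟪adjoint A x, x⟫_ℂ‖ = ‖⟪A x, x⟫_ℂ‖ := by
    rw [adjoint_inner_left, norm_inner_symm]
  calc ‖⟪(c • A + star c • adjoint A) x, x⟫_ℂ‖
      ≤ ‖c‖ * ‖⟪A x, x⟫_ℂ‖ + ‖c‖ * ‖⟪A x, x⟫_ℂ‖ := by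
        rw [add_apply, inner_add_left]
        refine (norm_add_le _ _).trans_eq ?_
        simp [inner_smul_left, hadj]
    _ = 2 * ‖c‖ * ‖⟪A x, x⟫_ℂ‖ := by ring
    _ ≤ 2 * ‖c‖ * nrad A := by gcongr; exact norm_inner_le_nrad A hx

theorem rpow_mul_norm_le_nrad {p : ℝ} (hp : 2 ≤ p) (A : H →L[ℂ] H) {c : ℂ} (hc : ‖c‖ = √2) :
    (2 : ℝ) ^ (1 / p - 2) * ‖c • A + star c • adjoint A‖ ≤ nrad A := by
  have hn : 0 ≤ nrad A := Real.iSup_nonneg fun _ => norm_nonneg _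
  have hexp : (2 : ℝ) ^ (1 / p - 2) * (2 * √2) ≤ 1 := by
    have h2 : 2 * √2 = (2 : ℝ) ^ (3 / 2 : ℝ) := by
      rw [Real.sqrt_eq_rpow, ← Real.rpow_one_add' zero_le_two (by norm_num)]
      norm_num
    rw [h2, ← Real.rpow_add zero_lt_two]
    have : 1 / p ≤ 1 / 2 := one_div_le_one_div_of_le zero_lt_two hp
    exact Real.rpow_le_one_of_one_le_of_nonpos one_le_two (by linarith)
  calc (2 : ℝ) ^ (1 / p - 2) * ‖c • A + star c • adjoint A‖
      ≤ 2 ^ (1 / p - 2) * (2 * √2 * nrad A) := by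
        gcongr
        exact hc ▸ norm_smul_add_smul_adjoint_le A c
    _ = 2 ^ (1 / p - 2) * (2 * √2) * nrad A := by ring
    _ ≤ nrad A := mul_le_of_le_one_left hn hexp

theorem stmt3 (A B C : H →L[ℂ] H)
    (hB : B = (2 : ℂ)⁻¹ • (A + adjoint A))
    (hC : C = (2 * Complex.I)⁻¹ • (A - adjoint A))
    (p : ℝ) (hp : 2 ≤ p) :
    wp2 p B C ≥ (2 : ℝ) ^ (1/p - 1) * max ‖B + C‖ ‖B - C‖ ∧
    nrad A ≥ (2 : ℝ) ^ (1/p - 2) *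
      max ‖(1 - Complex.I) • A + (1 + Complex.I) • adjoint A‖
          ‖(1 + Complex.I) • A + (1 - Complex.I) • adjoint A‖ := by
  have hBs : IsSelfAdjoint B := by
    rw [IsSelfAdjoint, hB, ← star_eq_adjoint]
    simp [add_comm]
  have hCs : IsSelfAdjoint C := by
    rw [IsSelfAdjoint, hC, ← star_eq_adjoint, star_smul, star_sub, star_star, ← neg_sub A, smul_neg,
      ← neg_smul]
    simp
  constructor
  · rw [ge_iff_le, mul_max_of_nonneg _ _ (by positivity)]
    refine max_le (rpow_mul_norm_le_wp2 (by linarith) (hBs.add hCs) fun x => ?_)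
      (rpow_mul_norm_le_wp2 (by linarith) (hBs.sub hCs) fun x => ?_)
    · rw [add_apply, inner_add_left]
      exact norm_add_le _ _
    · rw [sub_apply, inner_sub_left]
      exact norm_sub_le _ _
  · have h₁ : ‖1 - I‖ = √2 := by
      rw [norm_def]; congr 1; norm_num [normSq_apply]
    have h₂ : ‖1 + I‖ = √2 := by
      rw [norm_def]; congr 1; norm_num [normSq_apply]
    have hs₁ : star (1 - I) = 1 + I := by simp
    have hs₂ : star (1 + I) = 1 - I := by simp [sub_eq_add_neg]
    rw [ge_iff_le, mul_max_of_nonneg _ _ (by positivity)]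
    refine max_le ?_ ?_
    · simpa only [hs₁] using rpow_mul_norm_le_nrad hp A h₁
    · simpa only [hs₂] using rpow_mul_norm_le_nrad hp A h₂
end

section
/- Let T₁, …, Tₙ be bounded linear operators on a nonzero complex Hilbert space H, let p > 1, let α₁, …, αₙ ∈ [0,1] with Σ_{i=1}^n αᵢ = 1, and let ε₁, …, εₙ ∈ {+1, -1} be any choice of signs. Then w_p(T₁,…,Tₙ) ≥ w( Σ_{i=1}^n εᵢ · αᵢ^{1 - 1/p} · Tᵢ ). -/
open scoped InnerProductSpace
open ContinuousLinearMap Complex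

variable {H : Type*} [NormedAddCommGroup H] [InnerProductSpace ℂ H] [CompleteSpace H] [Nontrivial H]

/-- The generalized Euclidean operator radius `w_p` of an `n`-tuple of operators. -/
noncomputable def wpn (p : ℝ) {n : ℕ} (T : Fin n → H →L[ℂ] H) : ℝ :=
  ⨆ x : {x : H // ‖x‖ = 1}, (∑ i, ‖⟪T i x, x⟫_ℂ‖ ^ p) ^ (1/p)

theorem norm_inner_apply_self_le_opNorm {E : Type*} [NormedAddCommGroup E] [InnerProductSpace ℂ E]
    (S : E →L[ℂ] E) {x : E} (hx : ‖x‖ = 1) :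
    ‖⟪S x, x⟫_ℂ‖ ≤ ‖S‖ := by
  have h₁ := norm_inner_le_norm (𝕜 := ℂ) (S x) x
  have h₂ := S.le_opNorm x
  rw [hx, mul_one] at h₁ h₂
  exact h₁.trans h₂

theorem bddAbove_range_rpow_sum_norm_inner {E : Type*} [NormedAddCommGroup E] [InnerProductSpace ℂ E]
    {ι : Type*} [Fintype ι] {p : ℝ} (hp : 0 ≤ p) (T : ι → E →L[ℂ] E) :
    BddAbove (Set.range fun x : {x : E // ‖x‖ = 1} =>
      (∑ i, ‖⟪T i x, x⟫_ℂ‖ ^ p) ^ (1 / p)) := by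
  refine ⟨(∑ i, ‖T i‖ ^ p) ^ (1 / p), ?_⟩
  rintro _ ⟨x, rfl⟩
  dsimp only
  gcongr with i
  exact norm_inner_apply_self_le_opNorm (T i) x.2

/-- Hölder's inequality with the convex weights `α i` as the dual vector. -/
theorem sum_rpow_one_sub_mul_le_rpow_sum {ι : Type*} [Fintype ι] {p : ℝ} (hp : 1 < p)
    {α a : ι → ℝ} (hα : ∀ i, 0 ≤ α i) (hsum : ∑ i, α i = 1) (ha : ∀ i, 0 ≤ a i) :
    ∑ i, α i ^ (1 - 1 / p) * a i ≤ (∑ i, a i ^ p) ^ (1 / p) := by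
  have hpq := Real.HolderConjugate.conjExponent hp
  have hq : 1 - 1 / p = (p.conjExponent)⁻¹ := by
    rw [one_div, hpq.one_sub_inv]
  have h := Real.inner_le_Lp_mul_Lq_of_nonneg Finset.univ hpq.symm
    (f := fun i => α i ^ (1 - 1 / p)) (g := a)
    (fun i _ => Real.rpow_nonneg (hα i) _) (fun i _ => ha i)
  have hpow : ∀ i, (α i ^ (1 - 1 / p)) ^ p.conjExponent = α i := fun i => by
    rw [hq, Real.rpow_inv_rpow (hα i) hpq.symm.ne_zero]
  simpa only [hpow, hsum, Real.one_rpow, one_mul] using h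

theorem stmt15 {n : ℕ} (T : Fin n → H →L[ℂ] H) (p : ℝ) (hp : 1 < p)
    (α : Fin n → ℝ) (hα : ∀ i, α i ∈ Set.Icc (0 : ℝ) 1) (hsum : ∑ i, α i = 1)
    (ε : Fin n → ℝ) (hε : ∀ i, ε i = 1 ∨ ε i = -1) :
    wpn p T ≥ nrad (∑ i, ((ε i * α i ^ (1 - 1/p) : ℝ) : ℂ) • T i) := by
  have : Nonempty {x : H // ‖x‖ = 1} :=
    (exists_norm_eq H zero_le_one).elim fun x hx => ⟨⟨x, hx⟩⟩
  refine ciSup_mono (bddAbove_range_rpow_sum_norm_inner (by linarith) T) fun x => ?_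
  refine le_trans ?_ (sum_rpow_one_sub_mul_le_rpow_sum hp (fun i => (hα i).1) hsum
    fun i => norm_nonneg ⟪T i x, x⟫_ℂ)
  rw [sum_apply, sum_inner]
  refine (norm_sum_le _ _).trans (Finset.sum_le_sum fun i _ => le_of_eq ?_)
  have habs : |ε i| = 1 := by rcases hε i with h | h <;> simp [h]
  rw [smul_apply, inner_smul_left, norm_mul, RCLike.norm_conj, norm_real, Real.norm_eq_abs,
    abs_mul, habs, one_mul, abs_of_nonneg (Real.rpow_nonneg (hα i).1 _)]
end

section
/- Let (T₁,…,Tₙ) be an n-tuple of bounded linear operators on a nonzero complex Hilbert space H, let 0 ≤ α ≤ 1 and p ≥ 2. Then w_p(T₁,…,Tₙ) ≤ ‖ Σ_{i=1}^n ( α·|Tᵢ|^p + (1-α)·|Tᵢ*|^p ) ‖^{1/p}. In particular, for α = 1/2, w_p(T₁,…,Tₙ)^p ≤ (1/2) · ‖ Σ_{i=1}^n ( |Tᵢ|^p + |Tᵢ*|^p ) ‖. -/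
open scoped InnerProductSpace
open ContinuousLinearMap Complex

variable {H : Type*} [NormedAddCommGroup H] [InnerProductSpace ℂ H] [CompleteSpace H] [Nontrivial H]

/-- `|T| = (T*T)^{1/2}`. -/
noncomputable def opAbs (T : H →L[ℂ] H) : H →L[ℂ] H := CFC.sqrt (adjoint T * T)

/-- The real power `S^s` of a (positive) operator, via the continuous functional calculus. -/
noncomputable def opPow (S : H →L[ℂ] H) (s : ℝ) : H →L[ℂ] H := cfc (fun t : ℝ => t ^ s) S

theorem exists_tangent_le_rpow {c r : ℝ} (hc : 0 ≤ c) (hr : 1 ≤ r) :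
    ∃ k : ℝ, ∀ u : ℝ, 0 ≤ u → c ^ r + k * (u - c) ≤ u ^ r := by
  rcases hc.eq_or_lt with rfl | hc
  · exact ⟨0, fun u hu => by
      simpa [Real.zero_rpow (by linarith : r ≠ 0)] using Real.rpow_nonneg hu r⟩
  · refine ⟨c ^ r * (r / c), fun u hu => ?_⟩
    have hb := one_add_mul_self_le_rpow_one_add
      (by have : 0 ≤ u / c := by positivity
          linarith : -1 ≤ u / c - 1) hr
    rw [add_sub_cancel, Real.div_rpow hu hc.le, le_div_iff₀ (by positivity)] at hb
    calc c ^ r + c ^ r * (r / c) * (u - c) = (1 + r * (u / c - 1)) * c ^ r := by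
          field_simp
      _ ≤ u ^ r := hb

theorem wpn_nonneg {E : Type*} [NormedAddCommGroup E] [InnerProductSpace ℂ E] (p : ℝ)
    {n : ℕ} (T : Fin n → E →L[ℂ] E) : 0 ≤ wpn p T :=
  Real.iSup_nonneg fun _ => by positivity

section

variable {E : Type*} [NormedAddCommGroup E] [InnerProductSpace ℂ E] [CompleteSpace E]

theorem opAbs_nonneg (T : E →L[ℂ] E) : 0 ≤ opAbs T := CFC.sqrt_nonneg _

theorem opAbs_mul_self (T : E →L[ℂ] E) : opAbs T * opAbs T = adjoint T * T :=
  CFC.sqrt_mul_sqrt_self _ (star_mul_self_nonneg T)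

/-- McCarthy's inequality for `|T|²`. -/
theorem norm_rpow_le_re_inner_opPow_opAbs (T : E →L[ℂ] E) {p : ℝ} (hp : 2 ≤ p) {x : E}
    (hx : ‖x‖ = 1) : ‖T x‖ ^ p ≤ (⟪opPow (opAbs T) p x, x⟫_ℂ).re := by
  set S := opAbs T with hS
  have hS0 : 0 ≤ S := opAbs_nonneg T
  obtain ⟨k, hk⟩ := exists_tangent_le_rpow (sq_nonneg ‖T x‖) (by linarith : 1 ≤ p / 2)
  have hpow (t : ℝ) (ht : 0 ≤ t) : (t ^ 2) ^ (p / 2) = t ^ p := by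
    rw [← Real.rpow_natCast, ← Real.rpow_mul ht]
    congr 1
    push_cast
    ring
  rw [hpow _ (norm_nonneg _)] at hk
  have hmono : cfc (fun t : ℝ => (‖T x‖ ^ p - k * ‖T x‖ ^ 2) + k * t ^ 2) S ≤ opPow S p := by
    refine cfc_mono (fun t ht => ?_) (by fun_prop)
      (fun t _ => (Real.continuousAt_rpow_const t p (Or.inr (by linarith))).continuousWithinAt)
    have ht0 : 0 ≤ t := spectrum_nonneg_of_nonneg hS0 ht
    have := hk (t ^ 2) (sq_nonneg t)
    rw [hpow t ht0] at this
    linarith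
  have hcfc : cfc (fun t : ℝ => (‖T x‖ ^ p - k * ‖T x‖ ^ 2) + k * t ^ 2) S =
      algebraMap ℝ (E →L[ℂ] E) (‖T x‖ ^ p - k * ‖T x‖ ^ 2) + k • (adjoint T * T) := by
    have hsa : IsSelfAdjoint S := hS0.isSelfAdjoint
    rw [cfc_const_add _ _ S (by fun_prop), cfc_const_mul _ _ S (by fun_prop),
      cfc_pow_id (R := ℝ) S 2, sq S, hS, opAbs_mul_self]
  rw [hcfc, ContinuousLinearMap.le_def] at hmono
  have h := hmono.re_inner_nonneg_left x
  have hT : (⟪adjoint T (T x), x⟫_ℂ).re = ‖T x‖ ^ 2 := by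
    rw [adjoint_inner_left]
    exact inner_self_eq_norm_sq (𝕜 := ℂ) (T x)
  have hsmul (r : ℝ) (y : E) : (⟪r • y, x⟫_ℂ).re = r * (⟪y, x⟫_ℂ).re := by
    rw [RCLike.real_smul_eq_coe_smul (K := ℂ), inner_smul_left]
    simp
  simp [Algebra.algebraMap_eq_smul_one, inner_sub_left, inner_add_left, hsmul, hT, hx] at h
  linarith

theorem norm_inner_rpow_le_opPow (T : E →L[ℂ] E) {p : ℝ} (hp : 2 ≤ p) {x : E}
    (hx : ‖x‖ = 1) : ‖⟪T x, x⟫_ℂ‖ ^ p ≤ (⟪opPow (opAbs T) p x, x⟫_ℂ).re := by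
  refine le_trans (Real.rpow_le_rpow (norm_nonneg _) ?_ (by linarith))
    (norm_rpow_le_re_inner_opPow_opAbs T hp hx)
  simpa [hx] using norm_inner_le_norm (𝕜 := ℂ) (T x) x

theorem norm_inner_rpow_le_opPow_adjoint (T : E →L[ℂ] E) {p : ℝ} (hp : 2 ≤ p) {x : E}
    (hx : ‖x‖ = 1) : ‖⟪T x, x⟫_ℂ‖ ^ p ≤ (⟪opPow (opAbs (adjoint T)) p x, x⟫_ℂ).re := by
  have := norm_inner_rpow_le_opPow (adjoint T) hp hx
  rwa [adjoint_inner_left, norm_inner_symm] at this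

theorem sum_norm_inner_rpow_le {n : ℕ} (T : Fin n → E →L[ℂ] E) {α p : ℝ}
    (hα : α ∈ Set.Icc (0 : ℝ) 1) (hp : 2 ≤ p) {x : E} (hx : ‖x‖ = 1) :
    ∑ i, ‖⟪T i x, x⟫_ℂ‖ ^ p ≤
      ‖∑ i, ((α : ℂ) • opPow (opAbs (T i)) p +
              ((1 - α : ℝ) : ℂ) • opPow (opAbs (adjoint (T i))) p)‖ := by
  set A := ∑ i, ((α : ℂ) • opPow (opAbs (T i)) p +
              ((1 - α : ℝ) : ℂ) • opPow (opAbs (adjoint (T i))) p) with hA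
  have hAx : (⟪A x, x⟫_ℂ).re = ∑ i, (α * (⟪opPow (opAbs (T i)) p x, x⟫_ℂ).re +
      (1 - α) * (⟪opPow (opAbs (adjoint (T i))) p x, x⟫_ℂ).re) := by
    simp only [hA, sum_apply, add_apply, smul_apply, sum_inner, inner_add_left, inner_smul_left,
      Complex.conj_ofReal, Complex.re_sum, Complex.add_re, Complex.re_ofReal_mul]
  calc ∑ i, ‖⟪T i x, x⟫_ℂ‖ ^ p ≤ (⟪A x, x⟫_ℂ).re := by
        rw [hAx]
        refine Finset.sum_le_sum fun i _ => ?_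
        have h₁ := mul_le_mul_of_nonneg_left (norm_inner_rpow_le_opPow (T i) hp hx) hα.1
        have h₂ := mul_le_mul_of_nonneg_left (norm_inner_rpow_le_opPow_adjoint (T i) hp hx)
          (sub_nonneg.2 hα.2)
        linarith
    _ ≤ ‖⟪A x, x⟫_ℂ‖ := Complex.re_le_norm _
    _ ≤ ‖A x‖ * ‖x‖ := norm_inner_le_norm _ _
    _ ≤ ‖A‖ := by simpa [hx] using A.le_opNorm x

theorem wpn_le_norm_sum [Nontrivial E] {n : ℕ} (T : Fin n → E →L[ℂ] E) {α p : ℝ}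
    (hα : α ∈ Set.Icc (0 : ℝ) 1) (hp : 2 ≤ p) :
    wpn p T ≤
      ‖∑ i, ((α : ℂ) • opPow (opAbs (T i)) p +
              ((1 - α : ℝ) : ℂ) • opPow (opAbs (adjoint (T i))) p)‖ ^ (1/p) := by
  obtain ⟨x, hx⟩ := exists_norm_eq E zero_le_one
  have : Nonempty {x : E // ‖x‖ = 1} := ⟨⟨x, hx⟩⟩
  exact ciSup_le fun y => Real.rpow_le_rpow (by positivity)
    (sum_norm_inner_rpow_le T hα hp y.2) (by positivity)

end

theorem stmt19 {n : ℕ} (T : Fin n → H →L[ℂ] H) (α p : ℝ)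
    (hα : α ∈ Set.Icc (0 : ℝ) 1) (hp : 2 ≤ p) :
    wpn p T ≤
      ‖∑ i, ((α : ℂ) • opPow (opAbs (T i)) p +
              ((1 - α : ℝ) : ℂ) • opPow (opAbs (adjoint (T i))) p)‖ ^ (1/p) ∧
    wpn p T ^ p ≤
      (1/2 : ℝ) * ‖∑ i, (opPow (opAbs (T i)) p + opPow (opAbs (adjoint (T i))) p)‖ := by
  refine ⟨wpn_le_norm_sum T hα hp, ?_⟩
  have hp0 : p ≠ 0 := by linarith
  have h := Real.rpow_le_rpow (wpn_nonneg p T)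
    (wpn_le_norm_sum T (α := 1 / 2) ⟨by norm_num, by norm_num⟩ hp) (by linarith : 0 ≤ p)
  rw [← Real.rpow_mul (norm_nonneg _), one_div_mul_cancel hp0, Real.rpow_one] at h
  refine h.trans_eq ?_
  rw [show (1 - 1 / 2 : ℝ) = 1 / 2 by norm_num]
  simp_rw [← smul_add]
  rw [← Finset.smul_sum, norm_smul]
  norm_num
end
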